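/- Let λ ∈ 𝕏^∨, let x, y ∈ ^λW_aff with x ≠ y, and let t ∈ W_aff be a reflection with xt ∈ W_{aff,λ}y. Then x and y are comparable in Bruhat order; more precisely, if xt < x (in the Bruhat order of W_aff) then x > y, and if xt > x then x < y. -/

import Mathlib

noncomputable section

open Function Set

/-- An abstract interface for the set `𝒜` of alcoves of a finite root datum
`(𝕏, Φ', 𝕏^∨, (Φ')^∨)` with a chosen positive system `(Φ')⁺` (indexed by `PR`):
`V = 𝕏^∨ ⊗ ℝ` is the ambient space, `cowt` is the image of the coweight lattice
`𝕏^∨`, `pts a ⊆ V` is the alcove `a` as a subset (a connected component of the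
complement of the hyperplanes `⟨α,·⟩ = n`), `refl α n` is the affine reflection
`s_{(α,n)}` acting on alcoves, `transl a μ = a + μ` is translation, and the
partial order on `A` is the generic order generated by `A < α↑A`. -/
structure AlcoveSystem (V : Type) [AddCommGroup V] [Module ℝ V] [TopologicalSpace V]
    (PR : Type) [Finite PR] (A : Type) [PartialOrder A] where
  root : PR → V →ₗ[ℝ] ℝ
  coroot : PR → V
  root_coroot_two : ∀ α, root α (coroot α) = 2
  cowt : AddSubgroup V
  coroot_mem : ∀ α, coroot α ∈ cowt
  root_int : ∀ (α : PR) (v : V), v ∈ cowt → ∃ k : ℤ, root α v = (k : ℝ)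
  /-- the half-sum of positive coroots lies in `𝕏^∨` -/
  half_sum_coroots_mem : ∃ ρv ∈ cowt, (2 : ℝ) • ρv = ∑ᶠ α : PR, coroot α
  pts : A → Set V
  pts_injective : Function.Injective pts
  pts_nonempty : ∀ a, (pts a).Nonempty
  pts_off_walls : ∀ (a : A), ∀ v ∈ pts a, ∀ (α : PR) (k : ℤ), root α v ≠ (k : ℝ)
  refl : PR → ℤ → A → A
  refl_pts : ∀ α n a,
    pts (refl α n a) = (fun v => v - (root α v + (n : ℝ)) • coroot α) '' pts a
  transl : A → cowt → A
  transl_pts : ∀ (a) (μ : cowt), pts (transl a μ) = (fun v => v + (μ : V)) '' pts a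
  /-- the order on alcoves is generated by `A < α↑A`, where `α↑A = s_{(α,n)}A` for
  the unique `n` with `-1 < ⟨α,λ⟩ + n < 0` for all `λ ∈ A`. -/
  le_iff : ∀ a b : A, a ≤ b ↔
    Relation.ReflTransGen
      (fun a' b' => ∃ (α : PR) (n : ℤ),
        (∀ v ∈ pts a', -1 < root α v + (n : ℝ) ∧ root α v + (n : ℝ) < 0) ∧
        b' = refl α n a') a b

namespace AlcoveSystem

variable {V : Type} [AddCommGroup V] [Module ℝ V] [TopologicalSpace V]
variable {PR : Type} [Finite PR] {A : Type} [PartialOrder A]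

/-- The (open) dominant cone `{v | ⟨α,v⟩ > 0 for all α ∈ (Φ')⁺}`. -/
def domCone (S : AlcoveSystem V PR A) : Set V := {v : V | ∀ α : PR, 0 < S.root α v}

/-- A dominant alcove: an element of `𝒜⁺`. -/
def IsDominant (S : AlcoveSystem V PR A) (a : A) : Prop := S.pts a ⊆ S.domCone

end AlcoveSystem

/-- The affine Weyl group `(W_aff, S_aff)` of wall-crossings: a Coxeter system
(`cs.simple b`, `b : Bi`, are the simple reflections `S_aff`) acting simply
transitively on the set of alcoves on the right, each wall-crossing `A ↦ As`
being induced by an affine reflection. -/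
structure AlcoveCoxeter (V : Type) [AddCommGroup V] [Module ℝ V] [TopologicalSpace V]
    (PR : Type) [Finite PR] (A : Type) [PartialOrder A]
    (Bi : Type) (W : Type) [Group W]
    extends AlcoveSystem V PR A where
  M : CoxeterMatrix Bi
  cs : CoxeterSystem M W
  ract : A → W → A
  ract_one : ∀ a : A, ract a 1 = a
  ract_mul : ∀ (a : A) (x y : W), ract a (x * y) = ract (ract a x) y
  ract_simply_transitive : ∀ a b : A, ∃! x : W, ract a x = b
  /-- each simple wall-crossing is induced by an affine reflection of `V` -/
  simple_is_reflection : ∀ (b : Bi) (a : A), ∃ (α : PR) (n : ℤ), ract a (cs.simple b) = refl α n a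
  simple_moves : ∀ (b : Bi) (a : A), ract a (cs.simple b) ≠ a

namespace AlcoveCoxeter

variable {V : Type} [AddCommGroup V] [Module ℝ V] [TopologicalSpace V]
variable {PR : Type} [Finite PR] {A : Type} [PartialOrder A]
variable {Bi : Type} {W : Type} [Group W]

/-- The Bruhat order on `W_aff`: generated by `w < wt` for reflections `t` with
`ℓ(wt) > ℓ(w)`. -/
def bruhatLE (C : AlcoveCoxeter V PR A Bi W) (w w' : W) : Prop :=
  Relation.ReflTransGen
    (fun u u' => (∃ t : W, C.cs.IsReflection t ∧ u' = u * t) ∧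
      C.cs.length u < C.cs.length u') w w'

/-- The strict Bruhat order on `W_aff`. -/
def bruhatLT (C : AlcoveCoxeter V PR A Bi W) (w w' : W) : Prop :=
  C.bruhatLE w w' ∧ w ≠ w'

/-- `S_{aff,λ}`: the set of simple reflections `s` such that some face of type `s`
contains `λ` in its closure (equivalently, `λ` lies in the closure of both `A` and
`As` for some alcove `A`). -/
def Ssub (C : AlcoveCoxeter V PR A Bi W) (μ : V) : Set Bi :=
  {b : Bi | ∃ a : A,
    μ ∈ closure (C.pts a) ∧ μ ∈ closure (C.pts (C.ract a (C.cs.simple b)))}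

/-- The standard parabolic subgroup `W_{aff,λ}` generated by `S_{aff,λ}`. -/
def Wsub (C : AlcoveCoxeter V PR A Bi W) (μ : V) : Subgroup W :=
  Subgroup.closure (C.cs.simple '' C.Ssub μ)

/-- `^λW_aff`: the set of minimal length representatives of `W_{aff,λ}\W_aff`. -/
def minReps (C : AlcoveCoxeter V PR A Bi W) (μ : V) : Set W :=
  {w : W | ∀ u ∈ C.Wsub μ, C.cs.length w ≤ C.cs.length (u * w)}

end AlcoveCoxeter

namespace CoxeterSystem

variable {B : Type*} {W : Type*} [Group W] {M : CoxeterMatrix B} (cs : CoxeterSystem M W)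

open Classical in
/-- The involution of `W × ZMod 2` given by conjugation by the simple reflection `s i`, with the
sign flipped over `s i` itself. -/
def signedConjSimple (i : B) : Equiv.Perm (W × ZMod 2) :=
  Function.Involutive.toPerm
    (fun p => (cs.simple i * p.1 * cs.simple i, p.2 + if p.1 = cs.simple i then 1 else 0)) (by
      rintro ⟨t, e⟩
      have h : cs.simple i * t * cs.simple i = cs.simple i ↔ t = cs.simple i := by
        rw [mul_eq_right, ← mul_right_inj (cs.simple i), simple_mul_simple_cancel_left, mul_one]
      ext
      · simp [mul_assoc]
      · simp only [h, add_assoc, CharTwo.add_self_eq_zero, add_zero])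

open Classical in
theorem signedConjSimple_apply (i : B) (t : W) (e : ZMod 2) :
    cs.signedConjSimple i (t, e) =
      (cs.simple i * t * cs.simple i, e + if t = cs.simple i then 1 else 0) := rfl

open Classical in
theorem signedConjSimple_mul_pow_apply (i j : B) (m : ℕ) (t : W) (e : ZMod 2) :
    ((cs.signedConjSimple i * cs.signedConjSimple j) ^ m) (t, e) =
      ((cs.simple i * cs.simple j) ^ m * t * ((cs.simple i * cs.simple j) ^ m)⁻¹,
        e + ∑ n ∈ Finset.range (2 * m),
          if t = cs.simple j * (cs.simple i * cs.simple j) ^ n then 1 else 0) := by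
  induction m with
  | zero => simp
  | succ m ih =>
    set r := cs.simple i * cs.simple j with hr
    have hsemi : ∀ n : ℕ, (r ^ n)⁻¹ * cs.simple j = cs.simple j * r ^ n := by
      intro n
      have h : SemiconjBy (cs.simple j) r r⁻¹ := by
        simp [SemiconjBy, hr, mul_assoc]
      simpa using (h.pow_right n).eq.symm
    have h₁ : r ^ m * t * (r ^ m)⁻¹ = cs.simple j ↔ t = cs.simple j * r ^ (2 * m) := by
      rw [mul_inv_eq_iff_eq_mul, ← eq_inv_mul_iff_mul_eq, ← mul_assoc, hsemi, two_mul, pow_add,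
        mul_assoc]
    have h₂ : cs.simple j * (r ^ m * t * (r ^ m)⁻¹) * cs.simple j = cs.simple i ↔
        t = cs.simple j * r ^ (2 * m + 1) := by
      have h : cs.simple j * (r ^ m * t * (r ^ m)⁻¹) * cs.simple j = cs.simple i ↔
          r ^ m * t * (r ^ m)⁻¹ = cs.simple j * r := by
        rw [← mul_right_inj (cs.simple j), ← mul_left_inj (cs.simple j), hr]
        simp [mul_assoc]
      rw [h, mul_inv_eq_iff_eq_mul, ← eq_inv_mul_iff_mul_eq, mul_assoc, ← mul_assoc, hsemi,
        mul_assoc]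
      congr! 2
      rw [← pow_succ', ← pow_add]
      congr 1
      omega
    rw [pow_succ', Equiv.Perm.mul_apply, ih, Equiv.Perm.mul_apply, signedConjSimple_apply,
      signedConjSimple_apply]
    simp only [h₁, h₂]
    rw [show 2 * (m + 1) = 2 * m + 1 + 1 by ring, Finset.sum_range_succ, Finset.sum_range_succ]
    refine Prod.ext ?_ ?_
    · simp [pow_succ', hr, mul_assoc]
    · simp [add_assoc]

open Classical in
theorem signedConjSimple_mul_pow_eq_one {i j : B} {m : ℕ}
    (h : (cs.simple i * cs.simple j) ^ m = 1) :
    (cs.signedConjSimple i * cs.signedConjSimple j) ^ m = 1 := by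
  ext1 ⟨t, e⟩
  have hsum : ∑ n ∈ Finset.range m,
        (if t = cs.simple j * (cs.simple i * cs.simple j) ^ (m + n) then (1 : ZMod 2) else 0) =
      ∑ n ∈ Finset.range m,
        if t = cs.simple j * (cs.simple i * cs.simple j) ^ n then 1 else 0 :=
    Finset.sum_congr rfl fun n _ => by rw [pow_add, h, one_mul]
  rw [signedConjSimple_mul_pow_apply, two_mul, Finset.sum_range_add, hsum,
    CharTwo.add_self_eq_zero, h]
  simp

theorem isLiftable_signedConjSimple : M.IsLiftable cs.signedConjSimple := fun i j =>
  cs.signedConjSimple_mul_pow_eq_one (cs.simple_mul_simple_pow i j)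

/-- The action of `W` on `W × ZMod 2` by signed conjugation. -/
def signedConj : W →* Equiv.Perm (W × ZMod 2) :=
  cs.lift ⟨cs.signedConjSimple, cs.isLiftable_signedConjSimple⟩

/-- The parity of the number of occurrences of `t` in the right inversion sequence of any word
for `w`. -/
def inversionParity (w t : W) : ZMod 2 := (cs.signedConj w (t, 0)).2

theorem signedConj_apply (w t : W) (e : ZMod 2) :
    cs.signedConj w (t, e) = (w * t * w⁻¹, e + cs.inversionParity w t) := by
  suffices h : ∀ w : W, ∃ n : W → ZMod 2,
      ∀ t e, cs.signedConj w (t, e) = (w * t * w⁻¹, e + n t) by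
    obtain ⟨n, hn⟩ := h w
    simp [inversionParity, hn]
  intro w
  induction w using cs.simple_induction_left with
  | one => exact ⟨0, by simp⟩
  | mul_simple_left w i ih =>
    obtain ⟨n, hn⟩ := ih
    refine ⟨fun t => n t + (cs.signedConjSimple i (w * t * w⁻¹, 0)).2, fun t e => ?_⟩
    rw [map_mul, Equiv.Perm.mul_apply, hn, signedConj, lift_apply_simple]
    simp [signedConjSimple_apply, mul_assoc, add_assoc]

theorem inversionParity_mul (v w t : W) :
    cs.inversionParity (v * w) t =
      cs.inversionParity w t + cs.inversionParity v (w * t * w⁻¹) := by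
  conv_lhs => rw [inversionParity, map_mul, Equiv.Perm.mul_apply, signedConj_apply,
    signedConj_apply]
  simp

@[simp]
theorem inversionParity_one (t : W) : cs.inversionParity 1 t = 0 := by
  simp [inversionParity]

open Classical in
theorem inversionParity_simple (i : B) (t : W) :
    cs.inversionParity (cs.simple i) t = if t = cs.simple i then 1 else 0 := by
  simp [inversionParity, signedConj, signedConjSimple_apply]

theorem inversionParity_inv (w t : W) :
    cs.inversionParity w⁻¹ t = cs.inversionParity w (w⁻¹ * t * w) := by
  have h := cs.inversionParity_mul w w⁻¹ t
  rw [mul_inv_cancel, inversionParity_one, inv_inv] at h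
  exact CharTwo.add_eq_zero.mp h.symm

variable {cs} in
theorem IsReflection.inversionParity_self {t : W} (ht : cs.IsReflection t) :
    cs.inversionParity t t = 1 := by
  obtain ⟨w, i, rfl⟩ := ht
  have h : w⁻¹ * (w * cs.simple i * w⁻¹) * w⁻¹⁻¹ = cs.simple i := by group
  have h' : w⁻¹ * (w * cs.simple i * w⁻¹) * w = cs.simple i := by group
  rw [inversionParity_mul, inversionParity_mul, h, inversionParity_inv, h', inversionParity_simple]
  simp only [inv_simple, simple_mul_simple_self, one_mul, if_true]
  rw [add_left_comm, CharTwo.add_self_eq_zero, add_zero]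

theorem inversionParity_simple_ne_zero_iff (i : B) (t : W) :
    cs.inversionParity (cs.simple i) t ≠ 0 ↔ t = cs.simple i := by
  simp [inversionParity_simple]

theorem mem_rightInvSeq_of_inversionParity_ne_zero (ω : List B) {t : W}
    (h : cs.inversionParity (cs.wordProd ω) t ≠ 0) : t ∈ cs.rightInvSeq ω := by
  induction ω with
  | nil => simp at h
  | cons i ω ih =>
    rw [wordProd_cons, inversionParity_mul] at h
    rw [rightInvSeq, List.mem_cons]
    by_cases hω : cs.inversionParity (cs.wordProd ω) t = 0
    · left
      rw [hω, zero_add, inversionParity_simple_ne_zero_iff] at h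
      rw [← h]
      group
    · exact Or.inr (ih hω)

theorem length_mul_lt_of_inversionParity_ne_zero {w t : W} (h : cs.inversionParity w t ≠ 0) :
    cs.length (w * t) < cs.length w := by
  obtain ⟨ω, hω, rfl⟩ := cs.exists_isReduced w
  exact (cs.isRightInversion_of_mem_rightInvSeq hω
    (cs.mem_rightInvSeq_of_inversionParity_ne_zero ω h)).2

variable {cs} in
theorem IsReflection.inversionParity_eq_zero_iff {t : W} (ht : cs.IsReflection t) (w : W) :
    cs.inversionParity w t = 0 ↔ cs.length w < cs.length (w * t) := by
  refine ⟨fun h => ?_, fun h => ?_⟩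
  · have h' : cs.inversionParity (w * t) t ≠ 0 := by
      rw [inversionParity_mul, ht.inversionParity_self, mul_inv_cancel_right, h]
      decide
    simpa [mul_assoc, ht.mul_self] using cs.length_mul_lt_of_inversionParity_ne_zero h'
  · by_contra h'
    exact h.not_gt (cs.length_mul_lt_of_inversionParity_ne_zero h')

theorem mem_closure_of_inversionParity_ne_zero {I : Set B} {v r : W}
    (hv : v ∈ Subgroup.closure (cs.simple '' I)) (h : cs.inversionParity v r ≠ 0) :
    r ∈ Subgroup.closure (cs.simple '' I) := by
  induction hv using Subgroup.closure_induction generalizing r with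
  | mem _ hx =>
    obtain ⟨i, hi, rfl⟩ := hx
    rw [inversionParity_simple_ne_zero_iff] at h
    exact h ▸ Subgroup.subset_closure ⟨i, hi, rfl⟩
  | one => simp at h
  | mul v w hv hw ihv ihw =>
    rw [inversionParity_mul] at h
    by_cases hr : cs.inversionParity w r = 0
    · rw [hr, zero_add] at h
      have h' := ihv h
      rwa [Subgroup.mul_mem_cancel_right _ (inv_mem hw), Subgroup.mul_mem_cancel_left _ hw] at h'
    · exact ihw hr
  | inv v hv ih =>
    rw [inversionParity_inv] at h
    have h' := ih h
    rwa [Subgroup.mul_mem_cancel_right _ hv, Subgroup.mul_mem_cancel_left _ (inv_mem hv)] at h'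

end CoxeterSystem

namespace AlcoveCoxeter

variable {V : Type} [AddCommGroup V] [Module ℝ V] [TopologicalSpace V]
variable {PR : Type} [Finite PR] {A : Type} [PartialOrder A]
variable {Bi : Type} {W : Type} [Group W] (C : AlcoveCoxeter V PR A Bi W)

variable {C} in
theorem bruhatLE.length_le {w w' : W} (h : C.bruhatLE w w') :
    C.cs.length w ≤ C.cs.length w' := by
  induction h with
  | refl => rfl
  | tail _ h ih => exact ih.trans h.2.le

variable {C} in
theorem bruhatLT.length_lt {w w' : W} (h : C.bruhatLT w w') :
    C.cs.length w < C.cs.length w' := by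
  obtain ⟨h, hne⟩ := h
  rcases Relation.ReflTransGen.cases_tail h with h | ⟨v, hv, hstep⟩
  · exact absurd h.symm hne
  · exact (bruhatLE.length_le hv).trans_lt hstep.2

theorem bruhatLE_mul_of_mem_minReps {μ : V} {y u : W} (hy : y ∈ C.minReps μ)
    (hu : u ∈ C.Wsub μ) : C.bruhatLE y (u * y) := by
  induction hn : C.cs.length u using Nat.strong_induction_on generalizing u with
  | _ n ih =>
    by_cases h1 : u = 1
    · rw [h1, one_mul]
      exact Relation.ReflTransGen.refl
    obtain ⟨i, hi⟩ := C.cs.exists_rightDescent_of_ne_one h1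
    have hs := C.cs.isReflection_simple i
    have hpar : C.cs.inversionParity u (C.cs.simple i) ≠ 0 := fun h =>
      ((hs.inversionParity_eq_zero_iff _).mp h).not_gt hi
    have hmem : C.cs.simple i ∈ C.Wsub μ := C.cs.mem_closure_of_inversionParity_ne_zero hu hpar
    have ht : C.cs.IsReflection (y⁻¹ * C.cs.simple i * y) := by simpa using hs.conj y⁻¹
    have hyt : y * (y⁻¹ * C.cs.simple i * y) = C.cs.simple i * y := by group
    have hy0 : C.cs.inversionParity y (y⁻¹ * C.cs.simple i * y) = 0 := by
      rw [ht.inversionParity_eq_zero_iff, hyt]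
      exact (hy _ hmem).lt_of_ne (C.cs.length_simple_mul_ne y i).symm
    have hlt : C.cs.length (u * C.cs.simple i * y) < C.cs.length (u * y) := by
      have h := C.cs.length_mul_lt_of_inversionParity_ne_zero
        (w := u * y) (t := y⁻¹ * C.cs.simple i * y) (by
          rw [C.cs.inversionParity_mul, hy0, hyt, mul_inv_cancel_right, zero_add]
          exact hpar)
      rwa [mul_assoc, hyt, ← mul_assoc] at h
    refine Relation.ReflTransGen.tail (ih _ (hn ▸ hi) (mul_mem hu hmem) rfl)
      ⟨⟨_, ht, ?_⟩, hlt⟩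
    rw [mul_assoc (u * C.cs.simple i), hyt, mul_assoc u, C.cs.simple_mul_simple_cancel_left]

theorem eq_of_mem_minReps {μ : V} {x y u : W} (hx : x ∈ C.minReps μ) (hy : y ∈ C.minReps μ)
    (hu : u ∈ C.Wsub μ) (h : y = u * x) : x = y := by
  by_contra hne
  have hle : C.bruhatLE x y := h ▸ C.bruhatLE_mul_of_mem_minReps hx hu
  have hyx := hy _ (inv_mem hu)
  rw [h, inv_mul_cancel_left, ← h] at hyx
  exact (bruhatLT.length_lt ⟨hle, hne⟩).not_ge hyx

end AlcoveCoxeter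

open AlcoveCoxeter in
/-- **Statement 7**.
Let `λ ∈ 𝕏^∨`, let `x ≠ y` in `^λW_aff`, and let `t ∈ W_aff` be a reflection with
`xt ∈ W_{aff,λ} y`.  Then `x` and `y` are comparable in the Bruhat order; more
precisely, if `xt < x` then `x > y`, and if `xt > x` then `x < y`. -/
theorem comparable_of_reflection_between_minReps
    {V : Type} [AddCommGroup V] [Module ℝ V] [TopologicalSpace V]
    {PR : Type} [Finite PR] {A : Type} [PartialOrder A]
    {Bi : Type} {W : Type} [Group W]
    (C : AlcoveCoxeter V PR A Bi W) (lam : C.cowt)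
    (x y : W) (hx : x ∈ C.minReps (lam : V)) (hy : y ∈ C.minReps (lam : V))
    (hne : x ≠ y) (t : W) (ht : C.cs.IsReflection t)
    (hxt : ∃ u ∈ C.Wsub (lam : V), x * t = u * y) :
    (C.bruhatLT y x ∨ C.bruhatLT x y) ∧
    (C.bruhatLT (x * t) x → C.bruhatLT y x) ∧
    (C.bruhatLT x (x * t) → C.bruhatLT x y) := by
  obtain ⟨u, hu, hut⟩ := hxt
  have down : C.cs.length (x * t) < C.cs.length x → C.bruhatLT y x := by
    refine fun h => ⟨?_, hne.symm⟩
    have hy' : C.bruhatLE y (x * t) := hut ▸ C.bruhatLE_mul_of_mem_minReps hy hu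
    exact hy'.tail ⟨⟨t, ht, by rw [mul_assoc, ht.mul_self, mul_one]⟩, h⟩
  have up : C.cs.length x < C.cs.length (x * t) → C.bruhatLT x y := by
    refine fun h => ⟨?_, hne⟩
    have hy' : y = u⁻¹ * x * t := by rw [mul_assoc, hut, inv_mul_cancel_left]
    have hr : x * t * x⁻¹ ∉ C.Wsub (lam : V) := fun hr =>
      hne (C.eq_of_mem_minReps hx hy (mul_mem (inv_mem hu) hr) (by rw [hy']; group))
    have hpar : C.cs.inversionParity (u⁻¹ * x) t = 0 := by
      rw [C.cs.inversionParity_mul, (ht.inversionParity_eq_zero_iff _).mpr h, zero_add]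
      by_contra h0
      exact hr (C.cs.mem_closure_of_inversionParity_ne_zero (inv_mem hu) h0)
    refine Relation.ReflTransGen.tail (C.bruhatLE_mul_of_mem_minReps hx (inv_mem hu))
      ⟨⟨t, ht, hy'⟩, ?_⟩
    rw [hy']
    exact (ht.inversionParity_eq_zero_iff _).mp hpar
  refine ⟨?_, fun h => down h.length_lt, fun h => up h.length_lt⟩
  exact (ht.length_mul_left_ne x).lt_or_gt.imp down up
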